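/- Let 1 < α < 2. Then there exists M > 0 (depending only on α) such that for every x ≥ M, E_{α,2}(−x) ≥ 1 / (2 Γ(2−α) x). -/

import Mathlib

/-- The two-parameter Mittag-Leffler function `E_{α,β}(t) = ∑_{k=0}^∞ t^k / Γ(α k + β)`
on the real line, with `Γ` the real Gamma function. -/
noncomputable def mittagLeffler (α β t : ℝ) : ℝ :=
  ∑' k : ℕ, t ^ k / Real.Gamma (α * k + β)

open MeasureTheory Filter Topology Set

lemma ml_integrable_real {a r : ℝ} (ha : 0 < a) (hr : 0 < r) :
    IntegrableOn (fun t : ℝ => t ^ (a - 1) * Real.exp (-(r * t))) (Ioi 0) := by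
  have := integrableOn_rpow_mul_exp_neg_mul_rpow (p := 1) (s := a - 1) (b := r) (by linarith)
    one_pos hr
  simpa using this

lemma ml_laplace {a : ℝ} (ha : 0 < a) {z : ℂ} (hz : 0 < z.re) :
    ∫ t : ℝ in Ioi 0, ((t ^ (a - 1) : ℝ) : ℂ) * Complex.exp (-(z * t))
      = Real.Gamma a * z ^ (-(a : ℂ)) := by
  let d : ℝ → NNReal := fun t => Real.toNNReal (t ^ (a - 1))
  have hd : Measurable d := by fun_prop
  let μ : Measure ℝ := (volume.restrict (Ioi 0)).withDensity fun t => d t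
  let X : ℝ → ℝ := fun t => -t
  have hdt : ∀ t ∈ Ioi (0 : ℝ), ((d t : NNReal) : ℝ) = t ^ (a - 1) := fun t ht =>
    Real.coe_toNNReal _ (Real.rpow_nonneg (le_of_lt ht) _)
  have hM : ∀ w : ℂ, ProbabilityTheory.complexMGF X μ w =
      ∫ t : ℝ in Ioi 0, ((t ^ (a - 1) : ℝ) : ℂ) * Complex.exp (-(w * t)) := by
    intro w
    unfold ProbabilityTheory.complexMGF
    rw [integral_withDensity_eq_integral_smul hd]
    refine setIntegral_congr_fun measurableSet_Ioi fun t ht => ?_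
    simp only [NNReal.smul_def, hdt t ht, X]
    simp
  have hset : Ioi (0 : ℝ) ⊆ interior (ProbabilityTheory.integrableExpSet X μ) := by
    refine interior_maximal (fun r hr => ?_) isOpen_Ioi
    show Integrable _ μ
    rw [integrable_withDensity_iff_integrable_coe_smul hd]
    refine (integrableOn_congr_fun (fun t ht => ?_) measurableSet_Ioi).1 (ml_integrable_real ha hr)
    simp [hdt t ht, X]
  have hA : AnalyticOnNhd ℂ (ProbabilityTheory.complexMGF X μ) {w : ℂ | 0 < w.re} :=
    ProbabilityTheory.analyticOnNhd_complexMGF.mono fun w hw => hset hw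
  have hB : AnalyticOnNhd ℂ (fun w : ℂ => (Real.Gamma a : ℂ) * w ^ (-(a : ℂ))) {w : ℂ | 0 < w.re} := by
    refine DifferentiableOn.analyticOnNhd (fun w hw => ?_)
      (isOpen_lt continuous_const Complex.continuous_re)
    have : w ∈ Complex.slitPlane := Or.inl hw
    exact ((differentiableAt_id.cpow_const this).const_mul _).differentiableWithinAt
  have hreal : ∀ r : ℝ, 0 < r → ProbabilityTheory.complexMGF X μ (r : ℂ)
      = (Real.Gamma a : ℂ) * (r : ℂ) ^ (-(a : ℂ)) := by
    intro r hr
    rw [hM]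
    have h1 := Real.integral_rpow_mul_exp_neg_mul_Ioi ha hr
    have h2 : (r : ℂ) ^ (-(a : ℂ)) = ((r ^ (-a) : ℝ) : ℂ) := by
      rw [Complex.ofReal_cpow hr.le]; simp
    rw [h2, ← Complex.ofReal_mul, show Real.Gamma a * r ^ (-a) = (1 / r) ^ a * Real.Gamma a by
      rw [one_div, Real.inv_rpow hr.le, Real.rpow_neg hr.le]; ring, ← h1, ← integral_complex_ofReal]
    simp
  have hpre : IsPreconnected {w : ℂ | 0 < w.re} :=
    (convex_halfSpace_re_gt 0).isPreconnected
  have := AnalyticOnNhd.eqOn_of_preconnected_of_frequently_eq hA hB hpre (z₀ := (1 : ℂ))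
    (by simp) ?_
  · rw [← hM]; exact this hz
  · have h_real : ∃ᶠ (x : ℝ) in 𝓝[≠] (1 : ℝ), ProbabilityTheory.complexMGF X μ (x : ℂ)
      = (Real.Gamma a : ℂ) * (x : ℂ) ^ (-(a : ℂ)) := by
      refine Eventually.frequently ?_
      refine eventually_nhdsWithin_of_eventually_nhds ?_
      filter_upwards [lt_mem_nhds (zero_lt_one (α := ℝ))] with x hx using hreal x hx
    have ht : Tendsto (fun x : ℝ => (x : ℂ)) (𝓝[≠] (1 : ℝ)) (𝓝[≠] (1 : ℂ)) := by
      refine tendsto_nhdsWithin_iff.2 ⟨?_, ?_⟩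
      · exact (Complex.continuous_ofReal.tendsto' 1 1 (by simp)).mono_left nhdsWithin_le_nhds
      · filter_upwards [self_mem_nhdsWithin] with x hx
        simpa using hx
    exact ht.frequently h_real

lemma ml_vert_ne {c : ℝ} (hc : 0 < c) (w : ℝ) : ((c : ℂ) + w * Complex.I) ∈ Complex.slitPlane :=
  Or.inl (by simpa using hc)

lemma ml_vert_int {c a : ℝ} (hc : 0 < c) (ha : 1 < a) :
    Integrable (fun w : ℝ => ‖(c : ℂ) + w * Complex.I‖ ^ (-a)) := by
  have h := integrable_rpow_neg_one_add_norm_sq (E := ℝ) (μ := volume) (r := a) (by simpa using ha)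
  let k := min c 1
  have hk : 0 < k := lt_min hc one_pos
  refine (h.const_mul (k ^ (-a))).mono' ?_ (ae_of_all _ fun w => ?_)
  · refine Continuous.aestronglyMeasurable ?_
    refine Continuous.rpow_const (by fun_prop) fun w => Or.inl ?_
    exact norm_ne_zero_iff.2 (Complex.slitPlane_ne_zero (ml_vert_ne hc w))
  · have e : ‖(c : ℂ) + w * Complex.I‖ = Real.sqrt (c ^ 2 + w ^ 2) := by
      rw [Complex.norm_add_mul_I]
    rw [Real.norm_of_nonneg (by positivity), e]
    have e2 : (1 + ‖w‖ ^ 2) ^ (-a / 2) = (Real.sqrt (1 + w ^ 2)) ^ (-a) := by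
      rw [Real.sqrt_eq_rpow, ← Real.rpow_mul (by positivity), Real.norm_eq_abs, sq_abs]
      congr 1; ring
    rw [e2, ← Real.mul_rpow hk.le (by positivity)]
    refine Real.rpow_le_rpow_of_nonpos (by positivity) ?_ (by linarith)
    refine Real.le_sqrt_of_sq_le ?_
    rw [mul_pow, Real.sq_sqrt (by positivity)]
    have h1 : k ≤ c := min_le_left _ _
    have h2 : k ≤ 1 := min_le_right _ _
    have h3 : k ^ 2 ≤ c ^ 2 := by gcongr
    have h4 : k ^ 2 ≤ 1 := by nlinarith
    nlinarith [sq_nonneg w]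

lemma ml_vert_cpow_norm {c a : ℝ} (w : ℝ) :
    ‖((c : ℂ) + w * Complex.I) ^ (-(a : ℂ))‖ = ‖(c : ℂ) + w * Complex.I‖ ^ (-a) := by
  rw [← Complex.ofReal_neg, Complex.norm_cpow_real]

lemma ml_cont_cpow {c : ℝ} (hc : 0 < c) (a : ℂ) :
    Continuous (fun w : ℝ => ((c : ℂ) + w * Complex.I) ^ a) :=
  Continuous.cpow (by fun_prop) continuous_const (fun w => ml_vert_ne hc w)

lemma ml_inv_gamma {c a : ℝ} (hc : 0 < c) (ha : 1 < a) :
    ∫ w : ℝ, Complex.exp (c + w * Complex.I) * ((c : ℂ) + w * Complex.I) ^ (-(a : ℂ))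
      = ((2 * Real.pi / Real.Gamma a : ℝ) : ℂ) := by
  have ha0 : 0 < a := by linarith
  let f : ℝ → ℂ := (Ioi (0 : ℝ)).indicator
    fun t => (((t ^ (a - 1) * Real.exp (-(c * t)) : ℝ)) : ℂ)
  have hf : Integrable f := by
    rw [integrable_indicator_iff measurableSet_Ioi]
    exact (ml_integrable_real ha0 hc).ofReal
  have hF : ∀ ξ : ℝ, FourierTransform.fourier f ξ =
      Real.Gamma a * ((c : ℂ) + ((2 * Real.pi * ξ : ℝ) : ℂ) * Complex.I) ^ (-(a : ℂ)) := by
    intro ξ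
    rw [Real.fourier_real_eq_integral_exp_smul, ← ml_laplace ha0 (by simpa using hc),
      ← integral_indicator measurableSet_Ioi]
    congr 1
    ext t
    by_cases ht : t ∈ Ioi (0 : ℝ)
    · simp only [f, indicator_of_mem ht, smul_eq_mul]
      push_cast
      rw [mul_left_comm, ← Complex.exp_add]
      congr 2
      ring
    · simp only [f, indicator_of_notMem ht, smul_zero]
  have hFi : Integrable (FourierTransform.fourier f) := by
    rw [show FourierTransform.fourier f = _ from funext hF]
    refine Integrable.const_mul ?_ _
    have h1 : Integrable (fun w : ℝ => ((c : ℂ) + w * Complex.I) ^ (-(a : ℂ))) := by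
      refine (ml_vert_int hc ha).mono' (ml_cont_cpow hc _).aestronglyMeasurable
        (ae_of_all _ fun w => (ml_vert_cpow_norm w).le)
    exact h1.comp_mul_left' (R := 2 * Real.pi) (by positivity)
  have hcont : ContinuousAt f 1 := by
    have : f =ᶠ[𝓝 1] fun t => (((t ^ (a - 1) * Real.exp (-(c * t)) : ℝ)) : ℂ) := by
      filter_upwards [Ioi_mem_nhds (zero_lt_one (α := ℝ))] with t ht
      exact indicator_of_mem ht _
    refine ContinuousAt.congr ?_ this.symm
    refine Complex.continuous_ofReal.continuousAt.comp ?_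
    refine ContinuousAt.mul (Real.continuousAt_rpow_const _ _ (Or.inl one_ne_zero)) ?_
    fun_prop
  have key := hf.fourierInv_fourier_eq hFi hcont
  rw [Real.fourierInv_eq'] at key
  have hf1 : f 1 = (Real.exp (-c) : ℂ) := by
    simp [f]
  rw [hf1] at key
  have hG : (Real.Gamma a : ℂ) ≠ 0 := by
    exact_mod_cast (Real.Gamma_pos_of_pos ha0).ne'
  have e := MeasureTheory.Measure.integral_comp_mul_left
    (fun w : ℝ => Complex.exp (c + w * Complex.I) * ((c : ℂ) + w * Complex.I) ^ (-(a : ℂ)))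
    (2 * Real.pi)
  have e2 : ∫ ξ : ℝ, Complex.exp (c + ((2 * Real.pi * ξ : ℝ) : ℂ) * Complex.I) *
      ((c : ℂ) + ((2 * Real.pi * ξ : ℝ) : ℂ) * Complex.I) ^ (-(a : ℂ)) =
      Complex.exp c / Real.Gamma a * (Real.exp (-c) : ℂ) := by
    rw [← key, ← integral_const_mul]
    congr 1
    ext ξ
    rw [hF, Complex.exp_add]
    simp only [smul_eq_mul]
    have : inner ℝ ξ (1 : ℝ) = ξ := by simp
    rw [this]
    field_simp
  rw [e2] at e
  have hexp : Complex.exp c * (Real.exp (-c) : ℂ) = 1 := by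
    push_cast
    rw [← Complex.exp_add]; simp
  have hpi : (Real.pi : ℂ) ≠ 0 := by exact_mod_cast Real.pi_ne_zero
  have e3 : Complex.exp c / Real.Gamma a * (Real.exp (-c) : ℂ) = 1 / Real.Gamma a := by
    rw [div_mul_eq_mul_div, hexp]
  rw [e3, abs_of_pos (by positivity), Complex.real_smul] at e
  generalize (∫ w : ℝ, Complex.exp (c + w * Complex.I) * ((c : ℂ) + w * Complex.I) ^ (-(a : ℂ))) = J
    at e ⊢
  push_cast at e ⊢
  field_simp at e ⊢
  rw [← e]

noncomputable def mlP (α x : ℝ) (z : ℂ) : ℂ := (1 + x * z ^ (-(α : ℂ)))⁻¹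

noncomputable def mlK (α b x : ℝ) (z : ℂ) : ℂ :=
  Complex.exp z * z ^ (-((b + 1 : ℝ) : ℂ)) * ((b - α) * mlP α x z + α * mlP α x z ^ 2)

lemma ml_sin_pos {α : ℝ} (h1 : 1 < α) (h2 : α < 2) : 0 < Real.sin (α * (Real.pi / 2)) := by
  have := Real.pi_pos
  apply Real.sin_pos_of_pos_of_lt_pi <;> nlinarith

lemma ml_lower {α x : ℝ} (h1 : 1 < α) (h2 : α < 2) (hx : 0 ≤ x) {z : ℂ} (hz : 0 < z.re) :
    Real.sin (α * (Real.pi / 2)) ≤ ‖1 + x * z ^ (-(α : ℂ))‖ := by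
  have hpi := Real.pi_pos
  have harg : |z.arg| ≤ Real.pi / 2 := Complex.abs_arg_le_pi_div_two_iff.2 hz.le
  set r := x * ‖z‖ ^ (-α) with hr
  have hr0 : 0 ≤ r := by positivity
  have hcos : Real.cos (α * (Real.pi / 2)) ≤ Real.cos (z.arg * (-α)) := by
    rw [← Real.cos_abs (z.arg * (-α))]
    apply Real.cos_le_cos_of_nonneg_of_le_pi (abs_nonneg _)
    · nlinarith
    · rw [abs_mul, abs_neg, abs_of_pos (by linarith : 0 < α)]
      nlinarith
  refine abs_le_of_sq_le_sq' ?_ (norm_nonneg _) |>.2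
  rw [← Complex.normSq_eq_norm_sq, Complex.normSq_apply]
  have hre : (1 + x * z ^ (-(α : ℂ))).re = 1 + r * Real.cos (z.arg * (-α)) := by
    rw [← Complex.ofReal_neg, Complex.add_re, Complex.re_ofReal_mul, Complex.cpow_ofReal_re, hr]
    simp [mul_assoc]
  have him : (1 + x * z ^ (-(α : ℂ))).im = r * Real.sin (z.arg * (-α)) := by
    rw [← Complex.ofReal_neg, Complex.add_im, Complex.im_ofReal_mul, Complex.cpow_ofReal_im, hr]
    simp [mul_assoc]
  rw [hre, him]
  have t1 := Real.sin_sq_add_cos_sq (z.arg * (-α))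
  have t2 := Real.sin_sq_add_cos_sq (α * (Real.pi / 2))
  have t3 := mul_le_mul_of_nonneg_left hcos hr0
  have t4 : r ^ 2 * (Real.sin (z.arg * (-α)) ^ 2 + Real.cos (z.arg * (-α)) ^ 2) = r ^ 2 := by
    rw [t1, mul_one]
  nlinarith [sq_nonneg (r + Real.cos (α * (Real.pi / 2)))]

lemma ml_ne {α x : ℝ} (h1 : 1 < α) (h2 : α < 2) (hx : 0 ≤ x) {z : ℂ} (hz : 0 < z.re) :
    1 + x * z ^ (-(α : ℂ)) ≠ 0 :=
  norm_pos_iff.1 ((ml_sin_pos h1 h2).trans_le (ml_lower h1 h2 hx hz))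

lemma mlP_bound {α x : ℝ} (h1 : 1 < α) (h2 : α < 2) (hx : 0 ≤ x) {z : ℂ} (hz : 0 < z.re) :
    ‖mlP α x z‖ ≤ (Real.sin (α * (Real.pi / 2)))⁻¹ := by
  rw [mlP, norm_inv]
  exact inv_anti₀ (ml_sin_pos h1 h2) (ml_lower h1 h2 hx hz)

lemma mlK_diff {α b x : ℝ} (h1 : 1 < α) (h2 : α < 2) (hx : 0 ≤ x) :
    DifferentiableOn ℂ (mlK α b x) {z : ℂ | 0 < z.re} := by
  intro z hz
  refine DifferentiableAt.differentiableWithinAt ?_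
  have hs : z ∈ Complex.slitPlane := Or.inl hz
  have hp : ∀ a : ℂ, DifferentiableAt ℂ (fun z : ℂ => z ^ a) z := fun a =>
    differentiableAt_id.cpow_const hs
  have hP : DifferentiableAt ℂ (mlP α x) z := by
    unfold mlP
    exact (((hp _).const_mul _).const_add _).inv (ml_ne h1 h2 hx hz)
  unfold mlK
  exact (Complex.differentiableAt_exp.mul (hp _)).mul
    ((hP.const_mul _).add ((hP.pow 2).const_mul _))

lemma mlK_bound {α b : ℝ} (h1 : 1 < α) (h2 : α < 2) :
    ∃ C : ℝ, 0 ≤ C ∧ ∀ x : ℝ, 0 ≤ x → ∀ z : ℂ, 0 < z.re →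
      ‖mlK α b x z‖ ≤ C * Real.exp z.re * ‖z‖ ^ (-(b + 1)) := by
  set k := (Real.sin (α * (Real.pi / 2)))⁻¹
  have hk : 0 < k := inv_pos.2 (ml_sin_pos h1 h2)
  refine ⟨|b - α| * k + α * k ^ 2, by positivity, fun x hx z hz => ?_⟩
  have hP := mlP_bound h1 h2 hx hz
  rw [mlK, norm_mul, norm_mul, Complex.norm_exp, ← Complex.ofReal_neg, Complex.norm_cpow_real]
  have : ‖((b : ℂ) - α) * mlP α x z + α * mlP α x z ^ 2‖ ≤ |b - α| * k + α * k ^ 2 := by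
    refine (norm_add_le _ _).trans ?_
    rw [norm_mul, norm_mul, norm_pow, ← Complex.ofReal_sub, Complex.norm_real, Complex.norm_real,
      Real.norm_eq_abs, Real.norm_of_nonneg (by linarith : 0 ≤ α)]
    gcongr
  calc _ ≤ Real.exp z.re * ‖z‖ ^ (-(b + 1)) * (|b - α| * k + α * k ^ 2) := by gcongr
    _ = _ := by ring

lemma ml_vert_cont {G : ℂ → ℂ} (hG : DifferentiableOn ℂ G {z : ℂ | 0 < z.re}) {c : ℝ} (hc : 0 < c) :
    Continuous fun w : ℝ => G (c + w * Complex.I) := by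
  refine hG.continuousOn.comp_continuous (by fun_prop) fun w => ?_
  simpa using hc

lemma ml_vert_integrable {G : ℂ → ℂ} (hG : DifferentiableOn ℂ G {z : ℂ | 0 < z.re}) {b C : ℝ}
    (hb : 0 < b)
    (hbd : ∀ z : ℂ, 0 < z.re → ‖G z‖ ≤ C * Real.exp z.re * ‖z‖ ^ (-(b + 1)))
    {c : ℝ} (hc : 0 < c) : Integrable fun w : ℝ => G (c + w * Complex.I) := by
  refine ((ml_vert_int hc (by linarith : 1 < b + 1)).const_mul (C * Real.exp c)).mono'
    (ml_vert_cont hG hc).aestronglyMeasurable (ae_of_all _ fun w => ?_)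
  simpa using hbd (c + w * Complex.I) (by simpa using hc)

lemma ml_shift {G : ℂ → ℂ} (hG : DifferentiableOn ℂ G {z : ℂ | 0 < z.re}) {b C : ℝ} (hb : 0 < b)
    (hC : 0 ≤ C)
    (hbd : ∀ z : ℂ, 0 < z.re → ‖G z‖ ≤ C * Real.exp z.re * ‖z‖ ^ (-(b + 1)))
    {c d : ℝ} (hc : 0 < c) (hcd : c ≤ d) :
    ∫ w : ℝ, G (c + w * Complex.I) = ∫ w : ℝ, G (d + w * Complex.I) := by
  have hd : 0 < d := hc.trans_le hcd
  have hI : ∀ e : ℝ, 0 < e → Tendsto (fun T : ℝ => ∫ w in (-T)..T, G (e + w * Complex.I)) atTop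
      (𝓝 (∫ w : ℝ, G (e + w * Complex.I))) := fun e he =>
    intervalIntegral_tendsto_integral (ml_vert_integrable hG hb hbd he) tendsto_neg_atTop_atBot
      tendsto_id
  have hside : ∀ s : ℝ → ℝ, (∀ T, |s T| = |T|) →
      Tendsto (fun T : ℝ => ∫ u in c..d, G (u + s T * Complex.I)) atTop (𝓝 0) := by
    intro s hs
    have hlim : Tendsto (fun T : ℝ => C * Real.exp d * T ^ (-(b + 1)) * |d - c|) atTop (𝓝 0) := by
      have := ((tendsto_rpow_neg_atTop (by linarith : 0 < b + 1)).const_mul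
        (C * Real.exp d)).mul_const |d - c|
      simpa using this
    refine squeeze_zero_norm' ?_ hlim
    filter_upwards [eventually_gt_atTop 0] with T hT
    refine intervalIntegral.norm_integral_le_of_norm_le_const fun u hu => ?_
    rw [uIoc_of_le hcd] at hu
    have hu0 : 0 < u := hc.trans hu.1
    have h := hbd (u + s T * Complex.I) (by simpa using hu0)
    refine h.trans ?_
    have hre : ((u : ℂ) + s T * Complex.I).re = u := by simp
    have him : ((u : ℂ) + s T * Complex.I).im = s T := by simp
    rw [hre]
    have h3 : T ≤ ‖(u : ℂ) + s T * Complex.I‖ := by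
      have := Complex.abs_im_le_norm ((u : ℂ) + s T * Complex.I)
      rwa [him, hs, abs_of_pos hT] at this
    have h4 : ‖(u : ℂ) + s T * Complex.I‖ ^ (-(b + 1)) ≤ T ^ (-(b + 1)) :=
      Real.rpow_le_rpow_of_nonpos hT h3 (by linarith)
    have h5 : Real.exp u ≤ Real.exp d := Real.exp_le_exp.2 hu.2
    gcongr
  have h1 := hside (fun T => -T) (fun T => abs_neg T)
  have h2 := hside (fun T => T) (fun T => rfl)
  have hrect : ∀ T : ℝ, (∫ u in c..d, G (u + ((-T : ℝ) : ℂ) * Complex.I)) -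
      (∫ u in c..d, G (u + (T : ℂ) * Complex.I)) +
      Complex.I • (∫ w in (-T)..T, G (d + w * Complex.I)) -
      Complex.I • (∫ w in (-T)..T, G (c + w * Complex.I)) = 0 := by
    intro T
    have := Complex.integral_boundary_rect_eq_zero_of_differentiableOn G
      ⟨c, -T⟩ ⟨d, T⟩ (hG.mono fun z hz => ?_)
    · exact this
    · have := hz.1
      simp only [mem_preimage, uIcc_of_le hcd] at this
      exact hc.trans_le this.1
  have hlim := ((h1.sub h2).add ((hI d hd).const_smul Complex.I)).sub ((hI c hc).const_smul Complex.I)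
  have hz := tendsto_nhds_unique hlim (by simp only [hrect]; exact tendsto_const_nhds)
  simp only [sub_zero, zero_add, smul_eq_mul] at hz
  have := mul_left_cancel₀ Complex.I_ne_zero (sub_eq_zero.1 hz)
  exact this.symm

lemma ml_series {α b x c : ℝ} (h1 : 1 < α) (h2 : α < 2) (hb : 0 < b) (hx : 0 ≤ x) (hc : 0 < c)
    (hcx : x < c ^ α) :
    HasSum (fun j : ℕ => ((2 * Real.pi * ((-x) ^ j / Real.Gamma (α * j + b)) : ℝ) : ℂ))
      (∫ w : ℝ, mlK α b x (c + w * Complex.I)) := by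
  let F : ℕ → ℝ → ℂ := fun j w => ((((α * j + b) * (-x) ^ j : ℝ)) : ℂ) *
    (Complex.exp (c + w * Complex.I) *
      ((c : ℂ) + w * Complex.I) ^ (-((α * j + b + 1 : ℝ) : ℂ)))
  have hα : 0 < α := by linarith
  have hFint : ∀ j, ∫ w, F j w = ((2 * Real.pi * ((-x) ^ j / Real.Gamma (α * j + b)) : ℝ) : ℂ) := by
    intro j
    have hs : 0 < α * j + b := by positivity
    simp only [F]
    rw [integral_const_mul, ml_inv_gamma hc (by linarith), ← Complex.ofReal_mul,
      Real.Gamma_add_one hs.ne']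
    congr 1
    have := (Real.Gamma_pos_of_pos hs).ne'
    have := hs.ne'
    field_simp
  set ρ := x * c ^ (-α) with hρ
  have hρ0 : 0 ≤ ρ := by positivity
  have hρ1 : ρ < 1 := by
    rw [hρ, Real.rpow_neg hc.le, ← div_eq_mul_inv, div_lt_one (by positivity)]; exact hcx
  have hcn : ∀ w : ℝ, c ≤ ‖(c : ℂ) + w * Complex.I‖ := by
    intro w
    have := Complex.re_le_norm ((c : ℂ) + w * Complex.I)
    simpa using this
  have hFb : ∀ j w, ‖F j w‖ ≤ ((α * j + b) * ρ ^ j * Real.exp c) *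
      ‖(c : ℂ) + w * Complex.I‖ ^ (-(b + 1)) := by
    intro j w
    have hn : 0 < ‖(c : ℂ) + w * Complex.I‖ := hc.trans_le (hcn w)
    simp only [F]
    rw [norm_mul, norm_mul, Complex.norm_exp, ml_vert_cpow_norm, Complex.norm_real, norm_mul,
      norm_pow, norm_neg, Real.norm_of_nonneg hx, Real.norm_of_nonneg (by positivity)]
    have e1 : ‖(c : ℂ) + w * Complex.I‖ ^ (-(α * j + b + 1)) =
        (‖(c : ℂ) + w * Complex.I‖ ^ (-α)) ^ j * ‖(c : ℂ) + w * Complex.I‖ ^ (-(b + 1)) := by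
      rw [← Real.rpow_natCast, ← Real.rpow_mul hn.le, ← Real.rpow_add hn]
      congr 1; ring
    have e2 : ‖(c : ℂ) + w * Complex.I‖ ^ (-α) ≤ c ^ (-α) :=
      Real.rpow_le_rpow_of_nonpos hc (hcn w) (by linarith)
    have e3 : ((c : ℂ) + w * Complex.I).re = c := by simp
    rw [e1, e3, hρ, mul_pow]
    calc _ ≤ (α * j + b) * x ^ j * (Real.exp c *
          ((c ^ (-α)) ^ j * ‖(c : ℂ) + w * Complex.I‖ ^ (-(b + 1)))) := by gcongr
      _ = _ := by ring
  have hV := ml_vert_int hc (by linarith : 1 < b + 1)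
  have hFi : ∀ j, Integrable (F j) := by
    intro j
    refine (hV.const_mul _).mono' (Continuous.aestronglyMeasurable ?_) (ae_of_all _ (hFb j))
    exact continuous_const.mul ((by fun_prop : Continuous fun w : ℝ =>
      Complex.exp (c + w * Complex.I)).mul (ml_cont_cpow hc _))
  have hsumρ : Summable fun j : ℕ => (α * j + b) * ρ ^ j := by
    have s1 : Summable fun j : ℕ => (j : ℝ) * ρ ^ j :=
      (hasSum_coe_mul_geometric_of_norm_lt_one (by rwa [Real.norm_of_nonneg hρ0])).summable
    have s2 := summable_geometric_of_lt_one hρ0 hρ1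
    refine ((s1.mul_left α).add (s2.mul_left b)).congr fun j => ?_
    ring
  have hsum : Summable fun j => ∫ w, ‖F j w‖ := by
    refine Summable.of_nonneg_of_le (fun j => integral_nonneg fun w => norm_nonneg _)
      (fun j => ?_) ((hsumρ.mul_right (Real.exp c)).mul_right
        (∫ w : ℝ, ‖(c : ℂ) + w * Complex.I‖ ^ (-(b + 1))))
    rw [← integral_const_mul]
    exact integral_mono (hFi j).norm (hV.const_mul _) (hFb j)
  have key := hasSum_integral_of_summable_integral_norm hFi hsum
  simp only [hFint] at key
  suffices hI : ∀ w : ℝ, mlK α b x (c + w * Complex.I) = ∑' j, F j w by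
    simp only [hI]
    exact key
  intro w
  set z : ℂ := c + w * Complex.I with hz
  have hzre : 0 < z.re := by simpa [hz] using hc
  have hz0 : z ≠ 0 := Complex.slitPlane_ne_zero (Or.inl hzre)
  set q : ℂ := -(x * z ^ (-(α : ℂ))) with hq
  have hq1 : ‖q‖ < 1 := by
    rw [hq, norm_neg, norm_mul, ← Complex.ofReal_neg, Complex.norm_cpow_real, Complex.norm_real,
      Real.norm_of_nonneg hx]
    refine lt_of_le_of_lt ?_ hρ1
    have : ‖z‖ ^ (-α) ≤ c ^ (-α) := Real.rpow_le_rpow_of_nonpos hc (hcn w) (by linarith)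
    exact mul_le_mul_of_nonneg_left this hx
  have g1 := hasSum_coe_mul_geometric_of_norm_lt_one hq1
  have g2 := hasSum_geometric_of_norm_lt_one hq1
  have g := ((g1.mul_left (α : ℂ)).add (g2.mul_left (b : ℂ))).mul_left
    (Complex.exp z * z ^ (-((b + 1 : ℝ) : ℂ)))
  have hne : 1 - q ≠ 0 := by
    rw [hq, sub_neg_eq_add]; exact ml_ne h1 h2 hx hzre
  have hF : ∀ j, F j w = Complex.exp z * z ^ (-((b + 1 : ℝ) : ℂ)) *
      ((α : ℂ) * (j * q ^ j) + b * q ^ j) := by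
    intro j
    have e1 : z ^ (-((α * j + b + 1 : ℝ) : ℂ)) =
        (z ^ (-(α : ℂ))) ^ j * z ^ (-((b + 1 : ℝ) : ℂ)) := by
      rw [← Complex.cpow_nat_mul, ← Complex.cpow_add _ _ hz0]
      congr 1; push_cast; ring
    simp only [F]
    rw [← hz, e1, hq]
    push_cast
    rw [neg_pow (x : ℂ), neg_pow ((x : ℂ) * _), mul_pow]
    ring
  rw [tsum_congr hF, g.tsum_eq, mlK, mlP]
  rw [show (1 : ℂ) + x * z ^ (-(α : ℂ)) = 1 - q by rw [hq]; ring]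
  congr 1
  field_simp
  ring

lemma ml_vert_lim {α b : ℝ} (h1 : 1 < α) (h2 : α < 2) (hb : 0 < b) :
    Tendsto (fun x : ℝ => ∫ w : ℝ, mlK α b x ((1 : ℝ) + w * Complex.I)) atTop (𝓝 0) := by
  obtain ⟨C, hC, hbd⟩ := mlK_bound (b := b) h1 h2
  have h0 : (0 : ℂ) = ∫ w : ℝ, (0 : ℂ) := by simp
  rw [h0]
  refine tendsto_integral_filter_of_dominated_convergence
    (fun w : ℝ => C * Real.exp 1 * ‖((1 : ℝ) : ℂ) + w * Complex.I‖ ^ (-(b + 1))) ?_ ?_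
    ((ml_vert_int one_pos (by linarith : 1 < b + 1)).const_mul _) ?_
  · filter_upwards [eventually_ge_atTop 0] with x hx
    exact (ml_vert_cont (mlK_diff h1 h2 hx) one_pos).aestronglyMeasurable
  · filter_upwards [eventually_ge_atTop 0] with x hx
    refine ae_of_all _ fun w => ?_
    have := hbd x hx (((1 : ℝ) : ℂ) + w * Complex.I) (by simp)
    simpa using this
  · refine ae_of_all _ fun w => ?_
    set z : ℂ := ((1 : ℝ) : ℂ) + w * Complex.I with hz
    have hz0 : z ≠ 0 := Complex.slitPlane_ne_zero (ml_vert_ne one_pos w)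
    have hv : z ^ (-(α : ℂ)) ≠ 0 := by simp [Complex.cpow_eq_zero_iff, hz0]
    have hP : Tendsto (fun x : ℝ => mlP α x z) atTop (𝓝 0) := by
      unfold mlP
      refine tendsto_inv₀_cobounded.comp ?_
      rw [← tendsto_norm_atTop_iff_cobounded]
      have hl : Tendsto (fun x : ℝ => x * ‖z ^ (-(α : ℂ))‖ - 1) atTop atTop :=
        tendsto_atTop_add_const_right _ _ (tendsto_id.atTop_mul_const (norm_pos_iff.2 hv))
      refine tendsto_atTop_mono' _ ?_ hl
      filter_upwards [eventually_ge_atTop 0] with x hx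
      have := norm_sub_le (1 + x * z ^ (-(α : ℂ))) 1
      rw [add_sub_cancel_left, norm_mul, Complex.norm_real, Real.norm_of_nonneg hx, norm_one] at this
      linarith
    unfold mlK
    have := ((hP.const_mul ((b : ℂ) - α)).add ((hP.pow 2).const_mul (α : ℂ))).const_mul
      (Complex.exp z * z ^ (-((b + 1 : ℝ) : ℂ)))
    simpa using this

lemma ml_rep {α b x : ℝ} (h1 : 1 < α) (h2 : α < 2) (hb : 0 < b) (hx : 0 ≤ x) :
    HasSum (fun j : ℕ => ((2 * Real.pi * ((-x) ^ j / Real.Gamma (α * j + b)) : ℝ) : ℂ))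
      (∫ w : ℝ, mlK α b x ((1 : ℝ) + w * Complex.I)) := by
  obtain ⟨C, hC, hbd⟩ := mlK_bound (b := b) h1 h2
  have hd : x < (1 + x) ^ α := by
    have := Real.self_le_rpow_of_one_le (by linarith : 1 ≤ 1 + x) h1.le
    linarith
  rw [ml_shift (mlK_diff h1 h2 hx) hb hC (hbd x hx) one_pos (by linarith : (1 : ℝ) ≤ 1 + x)]
  exact ml_series h1 h2 hb hx (by linarith) hd

lemma ml_summable {α b x : ℝ} (h1 : 1 < α) (h2 : α < 2) (hb : 0 < b) (hx : 0 ≤ x) :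
    Summable (fun j : ℕ => (-x) ^ j / Real.Gamma (α * j + b)) := by
  have := Complex.summable_ofReal.1 (ml_rep h1 h2 hb hx).summable
  exact (summable_mul_left_iff (by positivity)).1 this

lemma ml_tendsto {α b : ℝ} (h1 : 1 < α) (h2 : α < 2) (hb : 0 < b) :
    Tendsto (fun x : ℝ => mittagLeffler α b (-x)) atTop (𝓝 0) := by
  have h := (ml_vert_lim h1 h2 hb).norm
  rw [norm_zero] at h
  refine squeeze_zero_norm' ?_ h
  filter_upwards [eventually_ge_atTop 0] with x hx
  rw [← (ml_rep h1 h2 hb hx).tsum_eq, ← Complex.ofReal_tsum, Complex.norm_real, tsum_mul_left,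
    norm_mul, mittagLeffler]
  have : (1 : ℝ) ≤ ‖2 * Real.pi‖ := by
    rw [Real.norm_of_nonneg (by positivity)]
    linarith [Real.pi_gt_three]
  exact le_mul_of_one_le_left (norm_nonneg _) this

/-- for `1 < α < 2` there is `M > 0` (depending only on `α`) such that
`E_{α,2}(−x) ≥ 1 / (2 Γ(2−α) x)` for all `x ≥ M`. -/
theorem mittagLeffler_lower_tail (α : ℝ) (hα1 : 1 < α) (hα2 : α < 2) :
    ∃ M : ℝ, 0 < M ∧ ∀ x : ℝ, M ≤ x →
      1 / (2 * Real.Gamma (2 - α) * x) ≤ mittagLeffler α 2 (-x) := by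
  have hb : 0 < 2 - α := by linarith
  have hG := Real.Gamma_pos_of_pos hb
  have hev := (ml_tendsto hα1 hα2 hb).eventually_le_const
    (by positivity : (0 : ℝ) < 1 / (2 * Real.Gamma (2 - α)))
  obtain ⟨N, hN⟩ := eventually_atTop.1 hev
  refine ⟨max N 1, by positivity, fun x hx => ?_⟩
  have hx1 : 1 ≤ x := (le_max_right _ _).trans hx
  have hx0 : 0 < x := by linarith
  have h := hN x ((le_max_left _ _).trans hx)
  have hrec : mittagLeffler α (2 - α) (-x) =
      1 / Real.Gamma (2 - α) - x * mittagLeffler α 2 (-x) := by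
    unfold mittagLeffler
    rw [(ml_summable hα1 hα2 hb hx0.le).tsum_eq_zero_add, ← tsum_mul_left,
      sub_eq_add_neg (1 / Real.Gamma (2 - α)), ← tsum_neg]
    congr 1
    · simp
    · refine tsum_congr fun k => ?_
      rw [show α * ((k + 1 : ℕ) : ℝ) + (2 - α) = α * k + 2 by push_cast; ring]
      ring
  rw [hrec] at h
  have e : 1 / Real.Gamma (2 - α) = 2 * (1 / (2 * Real.Gamma (2 - α))) := by field_simp
  rw [← div_div, div_le_iff₀ hx0]
  linarith
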